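/- (Right Cluster Classification) Let n, m ≥ 1, i ∈ Fin (4^n), j ∈ Fin (4^m), and let h = I_{2n} i ⊙ B_{2m} j be the pattern bit vector (of rank 2(n+m)) of the right-cluster function f_i ⋆ g_j. Then C_{I_{2(n+m)}} · a_h = e_i ⊗ (C_{I_{2m}} · a_{B_{2m} j}), where e_i is the i-th standard basis vector of ℝ^(4^n). In particular, the entry of C_{I_{2(n+m)}} · a_h at index k * 4^m + z is zero whenever k ≠ i, and has absolute value 2^(-m) when k = i; hence upon measurement the 2n most significant bits equal i with probability 1, identifying the promised-class component f_i. -/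

import Mathlib

/-- The product `p ⊙ q` of a pattern bit vector `p` of rank `n` with a pattern bit
vector `q` of rank `m`: `(p ⊙ q)(i * 2^m + j) = xor (p i) (q j)`. -/
def pbvProd {n m : ℕ} (p : Fin (2^n) → Bool) (q : Fin (2^m) → Bool) :
    Fin (2^(n+m)) → Bool :=
  fun k =>
    xor (p ⟨(k : ℕ) / 2^m, by
      have hk : (k : ℕ) < 2^m * 2^n :=
        lt_of_lt_of_eq k.isLt (by rw [pow_add, Nat.mul_comm])
      exact Nat.div_lt_of_lt_mul hk⟩)
      (q ⟨(k : ℕ) % 2^m, Nat.mod_lt _ (by positivity)⟩)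

/-- Two pattern bit vectors of rank `n` are orthogonal if their pointwise XOR equals
`true` at exactly `2^(n-1)` of the `2^n` indices. -/
def PBVOrthogonal {n : ℕ} (p q : Fin (2^n) → Bool) : Prop :=
  (Finset.univ.filter fun i => xor (p i) (q i) = true).card = 2^(n-1)

/-- The index `i * 2^m + j` as an element of `Fin (2^(n+m))`. -/
def finPair {n m : ℕ} (i : Fin (2^n)) (j : Fin (2^m)) : Fin (2^(n+m)) :=
  ⟨(i : ℕ) * 2^m + (j : ℕ), by
    calc (i : ℕ) * 2^m + (j : ℕ)
        < (i : ℕ) * 2^m + 2^m := Nat.add_lt_add_left j.isLt _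
      _ = ((i : ℕ) + 1) * 2^m := by ring
      _ ≤ 2^n * 2^m := Nat.mul_le_mul_right _ i.isLt
      _ = 2^(n+m) := (pow_add 2 n m).symm⟩

/-- The pattern ket of a pattern bit vector `p` of rank `n`:
`a_p i = 2^(-(n:ℝ)/2)` if `p i = false` and `a_p i = -2^(-(n:ℝ)/2)` if `p i = true`. -/
noncomputable def patternKet {n : ℕ} (p : Fin (2^n) → Bool) : Fin (2^n) → ℝ :=
  fun i => if p i then -(2 : ℝ) ^ (-(n : ℝ)/2) else (2 : ℝ) ^ (-(n : ℝ)/2)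

/-- Kronecker product of vectors: `(u ⊗ v)(i * 2^m + j) = u i * v j`. -/
noncomputable def vecKron {n m : ℕ} (u : Fin (2^n) → ℝ) (v : Fin (2^m) → ℝ) :
    Fin (2^(n+m)) → ℝ :=
  fun k =>
    u ⟨(k : ℕ) / 2^m, by
      have hk : (k : ℕ) < 2^m * 2^n :=
        lt_of_lt_of_eq k.isLt (by rw [pow_add, Nat.mul_comm])
      exact Nat.div_lt_of_lt_mul hk⟩ *
    v ⟨(k : ℕ) % 2^m, Nat.mod_lt _ (by positivity)⟩

/-- The base family `I₂`: `p_k i = decide (i = k)` for `k ∈ Fin 4`. -/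
def I2base : Fin (2^2) → Fin (2^2) → Bool := fun k i => decide (i = k)

/-- The recursively defined family `I_{2n}`:
`I_{2(n+1)} (i * 4^n + j) = p_i ⊙ I_{2n} j`. -/
def Ifam : (n : ℕ) → Fin (2^(2*n)) → Fin (2^(2*n)) → Bool
  | 0 => fun _ _ => false
  | n+1 => fun k z =>
      pbvProd (n := 2) (m := 2*n)
        (I2base ⟨(k : ℕ) / 2^(2*n), by
          have hk : (k : ℕ) < 2^(2*n) * 2^2 :=
            lt_of_lt_of_eq k.isLt
              (by rw [show 2*(n+1) = 2*n + 2 from by omega, pow_add])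
          exact Nat.div_lt_of_lt_mul hk⟩)
        (Ifam n ⟨(k : ℕ) % 2^(2*n), Nat.mod_lt _ (by positivity)⟩)
        (Fin.cast (congrArg (fun t => 2^t) (by omega : 2*(n+1) = 2 + 2*n)) z)

/-- The number of `1` bits in the binary representation of a natural number. -/
def Nat.popCount (n : ℕ) : ℕ := (Nat.bits n).count true

/-- The base family `B₂`: `e_k z = decide (Nat.popCount (k &&& z) % 2 = 1)` for `k ∈ Fin 4`. -/
def B2base : Fin (2^2) → Fin (2^2) → Bool :=
  fun k z => decide (Nat.popCount ((k : ℕ) &&& (z : ℕ)) % 2 = 1)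

/-- The recursively defined family `B_{2m}`:
`B_{2(m+1)} (i * 4^m + j) = e_i ⊙ B_{2m} j`. -/
def Bfam : (m : ℕ) → Fin (2^(2*m)) → Fin (2^(2*m)) → Bool
  | 0 => fun _ _ => false
  | m+1 => fun k z =>
      pbvProd (n := 2) (m := 2*m)
        (B2base ⟨(k : ℕ) / 2^(2*m), by
          have hk : (k : ℕ) < 2^(2*m) * 2^2 :=
            lt_of_lt_of_eq k.isLt
              (by rw [show 2*(m+1) = 2*m + 2 from by omega, pow_add])
          exact Nat.div_lt_of_lt_mul hk⟩)
        (Bfam m ⟨(k : ℕ) % 2^(2*m), Nat.mod_lt _ (by positivity)⟩)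
        (Fin.cast (congrArg (fun t => 2^t) (by omega : 2*(m+1) = 2 + 2*m)) z)

/-- The classifier matrix `C_{I₂}`: every diagonal entry is `-1/2`,
every off-diagonal entry is `1/2`. -/
noncomputable def CI2 : Matrix (Fin 4) (Fin 4) ℝ :=
  Matrix.of fun i j => if i = j then -(1/2 : ℝ) else 1/2

/-- Kronecker product of square matrices:
`(A ⊗ B)(i * M + j)(i' * M + j') = A i i' * B j j'`. -/
noncomputable def matKron {N M : ℕ} (A : Matrix (Fin N) (Fin N) ℝ)
    (B : Matrix (Fin M) (Fin M) ℝ) : Matrix (Fin (N*M)) (Fin (N*M)) ℝ :=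
  Matrix.of fun i j => A i.divNat j.divNat * B i.modNat j.modNat

/-- The `n`-fold Kronecker power `C_{I_{2n}}`, defined recursively by
`C_{I_{2(n+1)}} = C_{I₂} ⊗ C_{I_{2n}}`. -/
noncomputable def CIpow : (n : ℕ) → Matrix (Fin (2^(2*n))) (Fin (2^(2*n))) ℝ
  | 0 => 1
  | n+1 =>
      Matrix.of fun i j =>
        matKron CI2 (CIpow n)
          (Fin.cast (by rw [show 2*(n+1) = 2 + 2*n from by omega, pow_add]; norm_num) i)
          (Fin.cast (by rw [show 2*(n+1) = 2 + 2*n from by omega, pow_add]; norm_num) j)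

/-- Transport a pattern bit vector along an equality of ranks. -/
def pbvCast {a b : ℕ} (h : a = b) (p : Fin (2^a) → Bool) : Fin (2^b) → Bool :=
  fun z => p (Fin.cast (congrArg (fun t => 2^t) h.symm) z)

/-- Transport a real vector along an equality of ranks. -/
noncomputable def vecCast {a b : ℕ} (h : a = b) (u : Fin (2^a) → ℝ) : Fin (2^b) → ℝ :=
  fun z => u (Fin.cast (congrArg (fun t => 2^t) h.symm) z)

/-- The index `i * 2^c + j`, regarded as an element of `Fin (2^a)` when `b + c = a`. -/
def pairIndex {a b c : ℕ} (h : b + c = a) (i : Fin (2^b)) (j : Fin (2^c)) : Fin (2^a) :=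
  Fin.cast (congrArg (fun t => 2^t) h) (finPair i j)

lemma val_pairIndex {a b c : ℕ} (h : b + c = a) (i : Fin (2^b)) (j : Fin (2^c)) :
    (pairIndex h i j : ℕ) = i * 2^c + j := rfl

lemma val_pairIndex_div {a b c : ℕ} (h : b + c = a) (i : Fin (2^b)) (j : Fin (2^c)) :
    (pairIndex h i j : ℕ) / 2^c = i := by
  rw [val_pairIndex, Nat.add_comm, Nat.add_mul_div_right _ _ (by positivity),
    Nat.div_eq_of_lt j.isLt, Nat.zero_add]

lemma val_pairIndex_mod {a b c : ℕ} (h : b + c = a) (i : Fin (2^b)) (j : Fin (2^c)) :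
    (pairIndex h i j : ℕ) % 2^c = j := by
  rw [val_pairIndex, Nat.mul_add_mod_self_right, Nat.mod_eq_of_lt j.isLt]

lemma pairIndex_bijective {a b c : ℕ} (h : b + c = a) :
    Function.Bijective fun x : Fin (2^b) × Fin (2^c) => pairIndex h x.1 x.2 := by
  rw [Fintype.bijective_iff_injective_and_card]
  constructor
  · rintro ⟨i, j⟩ ⟨i', j'⟩ e
    have e' : pairIndex h i j = pairIndex h i' j' := e
    refine Prod.ext (Fin.ext ?_) (Fin.ext ?_)
    · rw [← val_pairIndex_div h i j, e', val_pairIndex_div]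
    · rw [← val_pairIndex_mod h i j, e', val_pairIndex_mod]
  · simp [← h, pow_add]

lemma pairIndex_inj {a b c : ℕ} (h : b + c = a) {i i' : Fin (2^b)} {j j' : Fin (2^c)} :
    pairIndex h i j = pairIndex h i' j' ↔ i = i' ∧ j = j' := by
  have := (pairIndex_bijective h).1.eq_iff (a := (i, j)) (b := (i', j'))
  simpa using this

lemma exists_pairIndex_eq {a b c : ℕ} (h : b + c = a) (k : Fin (2^a)) :
    ∃ i j, pairIndex h i j = k := by
  obtain ⟨x, hx⟩ := (pairIndex_bijective h).2 k
  exact ⟨x.1, x.2, hx⟩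

lemma pbvCast_pbvProd_pairIndex {a b c : ℕ} (h : b + c = a) (p : Fin (2^b) → Bool)
    (q : Fin (2^c) → Bool) (i : Fin (2^b)) (j : Fin (2^c)) :
    pbvCast h (pbvProd p q) (pairIndex h i j) = xor (p i) (q j) := by
  have hi := val_pairIndex_div h i j
  have hj := val_pairIndex_mod h i j
  simp only [pbvCast, pbvProd, Fin.val_cast, hi, hj]

lemma vecCast_vecKron_pairIndex {a b c : ℕ} (h : b + c = a) (u : Fin (2^b) → ℝ)
    (w : Fin (2^c) → ℝ) (i : Fin (2^b)) (j : Fin (2^c)) :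
    vecCast h (vecKron u w) (pairIndex h i j) = u i * w j := by
  have hi := val_pairIndex_div h i j
  have hj := val_pairIndex_mod h i j
  simp only [vecCast, vecKron, Fin.val_cast, hi, hj]

lemma patternKet_pairIndex {a b c : ℕ} (h : b + c = a) (p : Fin (2^b) → Bool)
    (q : Fin (2^c) → Bool) (i : Fin (2^b)) (j : Fin (2^c)) :
    patternKet (pbvCast h (pbvProd p q)) (pairIndex h i j) =
      patternKet p i * patternKet q j := by
  have e : (2 : ℝ) ^ (-(a : ℝ)/2) = 2 ^ (-(b : ℝ)/2) * 2 ^ (-(c : ℝ)/2) := by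
    rw [← Real.rpow_add two_pos, ← h]
    congr 1
    push_cast
    ring
  simp only [patternKet, pbvCast_pbvProd_pairIndex, e]
  cases p i <;> cases q j <;> simp

lemma mulVec_patternKet_pairIndex {a b c : ℕ} (h : b + c = a)
    {C : Matrix (Fin (2^a)) (Fin (2^a)) ℝ} {A : Matrix (Fin (2^b)) (Fin (2^b)) ℝ}
    {B : Matrix (Fin (2^c)) (Fin (2^c)) ℝ}
    (hC : ∀ i i' j j', C (pairIndex h i j) (pairIndex h i' j') = A i i' * B j j')
    (p : Fin (2^b) → Bool) (q : Fin (2^c) → Bool) (i : Fin (2^b)) (j : Fin (2^c)) :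
    C.mulVec (patternKet (pbvCast h (pbvProd p q))) (pairIndex h i j) =
      A.mulVec (patternKet p) i * B.mulVec (patternKet q) j := by
  simp only [Matrix.mulVec, dotProduct]
  rw [← (pairIndex_bijective h).sum_comp, Fintype.sum_mul_sum, Fintype.sum_prod_type]
  refine Finset.sum_congr rfl fun i' _ => Finset.sum_congr rfl fun j' _ => ?_
  rw [hC, patternKet_pairIndex]
  ring

lemma two_add_two_mul (n : ℕ) : 2 + 2*n = 2*(n+1) := by omega

lemma two_mul_add_two_mul (n m : ℕ) : 2*n + 2*m = 2*(n+m) := by omega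

lemma CIpow_succ_pairIndex (n : ℕ) (i i' : Fin (2^2)) (j j' : Fin (2^(2*n))) :
    CIpow (n+1) (pairIndex (two_add_two_mul n) i j) (pairIndex (two_add_two_mul n) i' j') =
      CI2 i i' * CIpow n j j' := by
  simp only [CIpow, matKron, Matrix.of_apply]
  congr 2 <;> apply Fin.ext <;>
    simp [val_pairIndex_div, val_pairIndex_mod]

lemma Ifam_succ_pairIndex (n : ℕ) (i : Fin (2^2)) (j : Fin (2^(2*n))) :
    Ifam (n+1) (pairIndex (two_add_two_mul n) i j) =
      pbvCast (two_add_two_mul n) (pbvProd (I2base i) (Ifam n j)) := by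
  funext z
  simp only [Ifam, pbvCast, val_pairIndex_div, val_pairIndex_mod]

lemma Bfam_succ_pairIndex (n : ℕ) (i : Fin (2^2)) (j : Fin (2^(2*n))) :
    Bfam (n+1) (pairIndex (two_add_two_mul n) i j) =
      pbvCast (two_add_two_mul n) (pbvProd (B2base i) (Bfam n j)) := by
  funext z
  simp only [Bfam, pbvCast, val_pairIndex_div, val_pairIndex_mod]

lemma val_pairIndex_div_mod_of_lt {a b m t : ℕ} (h : b + 2*m = a) (i : Fin (2^b))
    (j : Fin (2^(2*m))) (ht : t < m) : (pairIndex h i j : ℕ) / 4^t % 4 = j / 4^t % 4 := by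
  rw [val_pairIndex]
  generalize (j : ℕ) = y
  obtain ⟨s, rfl⟩ := Nat.exists_eq_add_of_lt ht
  have hp : (2 : ℕ)^(2*(t+s+1)) = 4^s * 4 * 4^t := by
    rw [pow_mul]
    norm_num
    ring
  rw [hp, show (i : ℕ) * (4^s * 4 * 4^t) + y = y + (i * 4^s * 4) * 4^t by ring,
    Nat.add_mul_div_right _ _ (by positivity), Nat.add_mul_mod_self_right]

/-- Each entry of `CIpow n` is a product over base-4 digits. -/
lemma CIpow_apply (n : ℕ) (x y : Fin (2^(2*n))) :
    CIpow n x y = ∏ t ∈ Finset.range n,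
      if (x : ℕ) / 4^t % 4 = (y : ℕ) / 4^t % 4 then -(1/2 : ℝ) else 1/2 := by
  induction n with
  | zero =>
    have : Subsingleton (Fin (2^(2*0))) := inferInstanceAs (Subsingleton (Fin 1))
    rw [Subsingleton.elim x y, Finset.range_zero, Finset.prod_empty]
    exact Matrix.one_apply_eq y
  | succ n ih =>
    obtain ⟨i, j, rfl⟩ := exists_pairIndex_eq (two_add_two_mul n) x
    obtain ⟨i', j', rfl⟩ := exists_pairIndex_eq (two_add_two_mul n) y
    have hp : (2 : ℕ)^(2*n) = 4^n := by rw [pow_mul]; norm_num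
    have hhigh (i : Fin (2^2)) (j : Fin (2^(2*n))) :
        (pairIndex (two_add_two_mul n) i j : ℕ) / 4^n % 4 = i := by
      rw [← hp, val_pairIndex_div]
      exact Nat.mod_eq_of_lt i.isLt
    rw [CIpow_succ_pairIndex, Finset.prod_range_succ, ih, mul_comm, hhigh, hhigh]
    congr 1
    · refine Finset.prod_congr rfl fun t ht => ?_
      rw [val_pairIndex_div_mod_of_lt _ _ _ (Finset.mem_range.1 ht),
        val_pairIndex_div_mod_of_lt _ _ _ (Finset.mem_range.1 ht)]
    · simp only [CI2, Matrix.of_apply, Fin.val_inj]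

lemma CIpow_add_pairIndex (n m : ℕ) (i i' : Fin (2^(2*n))) (j j' : Fin (2^(2*m))) :
    CIpow (n+m) (pairIndex (two_mul_add_two_mul n m) i j)
      (pairIndex (two_mul_add_two_mul n m) i' j') = CIpow n i i' * CIpow m j j' := by
  have hp : (2 : ℕ)^(2*m) = 4^m := by rw [pow_mul]; norm_num
  have hhigh (i : Fin (2^(2*n))) (j : Fin (2^(2*m))) (t : ℕ) :
      (pairIndex (two_mul_add_two_mul n m) i j : ℕ) / 4^(m+t) % 4 = i / 4^t % 4 := by
    rw [pow_add, ← Nat.div_div_eq_div_mul, ← hp, val_pairIndex_div]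
  rw [CIpow_apply, CIpow_apply, CIpow_apply,
    congrArg (fun N => Finset.prod (Finset.range N) _) (add_comm n m),
    Finset.prod_range_add, mul_comm]
  congr 1
  · exact Finset.prod_congr rfl fun t _ => by rw [hhigh, hhigh]
  · refine Finset.prod_congr rfl fun t ht => ?_
    rw [val_pairIndex_div_mod_of_lt _ _ _ (Finset.mem_range.1 ht),
      val_pairIndex_div_mod_of_lt _ _ _ (Finset.mem_range.1 ht)]

lemma patternKet_rank_two (p : Fin (2^2) → Bool) (z : Fin (2^2)) :
    patternKet p z = if p z then -(1/2 : ℝ) else 1/2 := by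
  have e : (2 : ℝ) ^ (-((2 : ℕ) : ℝ)/2) = 1/2 := by
    rw [show -((2 : ℕ) : ℝ)/2 = -1 by norm_num, Real.rpow_neg_one]
    norm_num
  simp only [patternKet, e]

lemma CI2_mulVec_I2base (i k : Fin (2^2)) :
    Matrix.mulVec CI2 (patternKet (I2base i)) k = if k = i then 1 else 0 := by
  rw [funext (patternKet_rank_two (I2base i))]
  simp only [Matrix.mulVec, dotProduct, CI2, Matrix.of_apply, I2base]
  change (∑ x : Fin 4, _) = _
  rw [Fin.sum_univ_four]
  fin_cases i <;> fin_cases k <;> norm_num [Fin.ext_iff]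

lemma B2base_eq (k z : Fin (2^2)) :
    B2base k z = decide ((k % 2 * (z % 2) + k / 2 * (z / 2) : ℕ) % 2 = 1) := by
  revert k z
  decide

lemma abs_CI2_mulVec_B2base (j z : Fin (2^2)) :
    |Matrix.mulVec CI2 (patternKet (B2base j)) z| = 1/2 := by
  rw [funext (patternKet_rank_two (B2base j))]
  simp only [Matrix.mulVec, dotProduct, CI2, Matrix.of_apply, B2base_eq]
  change |∑ x : Fin 4, _| = _
  rw [Fin.sum_univ_four]
  fin_cases j <;> fin_cases z <;> norm_num [Fin.ext_iff]

lemma CIpow_mulVec_Ifam (n : ℕ) (i k : Fin (2^(2*n))) :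
    (CIpow n).mulVec (patternKet (Ifam n i)) k = if k = i then 1 else 0 := by
  induction n with
  | zero =>
    have : Subsingleton (Fin (2^(2*0))) := inferInstanceAs (Subsingleton (Fin 1))
    simp [CIpow, Ifam, patternKet, Subsingleton.elim k i]
  | succ n ih =>
    obtain ⟨i, i', rfl⟩ := exists_pairIndex_eq (two_add_two_mul n) i
    obtain ⟨k, k', rfl⟩ := exists_pairIndex_eq (two_add_two_mul n) k
    rw [Ifam_succ_pairIndex,
      mulVec_patternKet_pairIndex (two_add_two_mul n) (CIpow_succ_pairIndex n),
      CI2_mulVec_I2base, ih, ite_zero_mul_ite_zero, mul_one]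
    simp only [pairIndex_inj]

lemma abs_CIpow_mulVec_Bfam (m : ℕ) (j z : Fin (2^(2*m))) :
    |(CIpow m).mulVec (patternKet (Bfam m j)) z| = ((2 : ℝ)^m)⁻¹ := by
  induction m with
  | zero => simp [CIpow, Bfam, patternKet]
  | succ m ih =>
    obtain ⟨j, j', rfl⟩ := exists_pairIndex_eq (two_add_two_mul m) j
    obtain ⟨z, z', rfl⟩ := exists_pairIndex_eq (two_add_two_mul m) z
    rw [Bfam_succ_pairIndex,
      mulVec_patternKet_pairIndex (two_add_two_mul m) (CIpow_succ_pairIndex m),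
      abs_mul, abs_CI2_mulVec_B2base, ih, pow_succ, mul_inv, mul_comm, one_div]

/-- **Right Cluster Classification.** Let `h = I_{2n} i ⊙ B_{2m} j` be the
pattern bit vector (of rank `2(n+m)`) of the right-cluster function `f_i ⋆ g_j`. Then
`C_{I_{2(n+m)}} · a_h = e_i ⊗ (C_{I_{2m}} · a_{B_{2m} j})`; in particular the entry at
index `k * 4^m + z` vanishes for `k ≠ i` and has absolute value `2^(-m)` for `k = i`,
so measurement identifies the promised-class component `f_i` with probability 1. -/
theorem right_cluster_classification (n m : ℕ) (hn : 1 ≤ n) (hm : 1 ≤ m)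
    (i : Fin (2^(2*n))) (j : Fin (2^(2*m)))
    (h : Fin (2^(2*(n+m))) → Bool)
    (hh : h = pbvCast (by omega : 2*n + 2*m = 2*(n+m)) (pbvProd (Ifam n i) (Bfam m j)))
    (v : Fin (2^(2*(n+m))) → ℝ)
    (hv : v = (CIpow (n+m)).mulVec (patternKet h)) :
    v = vecCast (by omega : 2*n + 2*m = 2*(n+m))
          (vecKron (fun k => if k = i then (1 : ℝ) else 0)
            ((CIpow m).mulVec (patternKet (Bfam m j)))) ∧
    (∀ (k : Fin (2^(2*n))) (z : Fin (2^(2*m))), k ≠ i →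
      v (Fin.cast (congrArg (fun t => 2^t) (by omega : 2*n + 2*m = 2*(n+m)))
          (finPair k z)) = 0) ∧
    (∀ z : Fin (2^(2*m)),
      |v (Fin.cast (congrArg (fun t => 2^t) (by omega : 2*n + 2*m = 2*(n+m)))
          (finPair i z))| = ((2 : ℝ)^m)⁻¹) := by
  have hblock (k : Fin (2^(2*n))) (z : Fin (2^(2*m))) :
      v (pairIndex (two_mul_add_two_mul n m) k z) =
        (if k = i then 1 else 0) * (CIpow m).mulVec (patternKet (Bfam m j)) z := by
    rw [hv, hh, mulVec_patternKet_pairIndex _ (CIpow_add_pairIndex n m), CIpow_mulVec_Ifam]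
  refine ⟨funext fun x => ?_, fun k z hk => ?_, fun z => ?_⟩
  · obtain ⟨k, z, rfl⟩ := exists_pairIndex_eq (two_mul_add_two_mul n m) x
    rw [hblock, vecCast_vecKron_pairIndex]
  · exact (hblock k z).trans (by rw [if_neg hk, zero_mul])
  · refine (congrArg abs (hblock i z)).trans ?_
    rw [if_pos rfl, one_mul, abs_CIpow_mulVec_Bfam]
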